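/- There do not exist a finite group G and subgroups N, M ∈ CD(G) with N < M such that every K ∈ CD(G) satisfies N ≤ K ≤ M, any two K, K' ∈ CD(G) with N < K ≤ K' < M are equal, the set of subgroups K ∈ CD(G) with N < K < M has exactly 6 elements, and exactly 4 of those subgroups K are abelian. -/

import Mathlib

/-- The Chermak-Delgado measure of a subgroup `H` of a finite group `G`:
`m_G(H) = |H| · |C_G(H)|`. -/
noncomputable def CDmeasure {G : Type*} [Group G] (H : Subgroup G) : ℕ :=
  Nat.card H * Nat.card (Subgroup.centralizer (H : Set G))

/-- `H` belongs to the Chermak-Delgado lattice of `G`: its measure is maximal. -/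
def inCD {G : Type*} [Group G] (H : Subgroup G) : Prop :=
  ∀ K : Subgroup G, CDmeasure K ≤ CDmeasure H

open scoped Pointwise commutatorElement

/-- Product formula. -/
theorem card_mul_inf {G : Type*} [Group G] [Finite G] (H K : Subgroup G) :
    Nat.card ((H : Set G) * (K : Set G) : Set G) * Nat.card (H ⊓ K : Subgroup G)
      = Nat.card H * Nat.card K := by
  have hch : ∀ p : ((H : Set G) * (K : Set G) : Set G), ∃ q : H × K, (q.1 : G) * q.2 = p := by
    rintro ⟨p, hp⟩
    obtain ⟨h, hh, k, hk, rfl⟩ := Set.mem_mul.1 hp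
    exact ⟨(⟨h, hh⟩, ⟨k, hk⟩), rfl⟩
  choose s hs using hch
  rw [← Nat.card_prod, ← Nat.card_prod]
  let F : ((H : Set G) * (K : Set G) : Set G) × (H ⊓ K : Subgroup G) → H × K := fun z =>
    (⟨(s z.1).1 * z.2, H.mul_mem (s z.1).1.2 z.2.2.1⟩,
     ⟨(z.2 : G)⁻¹ * (s z.1).2, K.mul_mem (K.inv_mem z.2.2.2) (s z.1).2.2⟩)
  refine Nat.card_congr (Equiv.ofBijective F ⟨?_, ?_⟩)
  · rintro ⟨p, d⟩ ⟨p', d'⟩ h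
    have h1 : ((s p).1 : G) * d = (s p').1 * d' := congrArg (fun z : H × K => (z.1 : G)) h
    have h2 : (d : G)⁻¹ * (s p).2 = (d' : G)⁻¹ * (s p').2 :=
      congrArg (fun z : H × K => (z.2 : G)) h
    have h3 : (p : G) = p' := by
      rw [← hs p, ← hs p']
      calc ((s p).1 : G) * (s p).2 = ((s p).1 * d) * ((d : G)⁻¹ * (s p).2) := by group
        _ = _ := by rw [h1, h2]; group
    obtain rfl := Subtype.ext h3
    have := mul_left_cancel h1
    rw [Subtype.ext this]
  · rintro ⟨h, k⟩
    let p : ((H : Set G) * (K : Set G) : Set G) := ⟨h * k, Set.mul_mem_mul h.2 k.2⟩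
    have hp : ((s p).1 : G) * (s p).2 = h * k := hs p
    have e : ((s p).1 : G)⁻¹ * h = (s p).2 * (k : G)⁻¹ := by
      rw [inv_mul_eq_iff_eq_mul, ← mul_assoc, hp]; group
    refine ⟨(p, ⟨((s p).1 : G)⁻¹ * h, H.mul_mem (H.inv_mem (s p).1.2) h.2, ?_⟩), ?_⟩
    · rw [e]; exact K.mul_mem (s p).2.2 (K.inv_mem k.2)
    · apply Prod.ext
      · apply Subtype.ext; simp [F]
      · apply Subtype.ext
        change (((s p).1 : G)⁻¹ * h)⁻¹ * (s p).2 = k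
        rw [e]; group

theorem inCD_centralizer {G : Type*} [Group G] [Finite G] {H : Subgroup G} (h : inCD H) :
    inCD (Subgroup.centralizer (H : Set G)) ∧
      Subgroup.centralizer ((Subgroup.centralizer (H : Set G) : Subgroup G) : Set G) = H := by
  have hle : H ≤ Subgroup.centralizer ((Subgroup.centralizer (H : Set G) : Subgroup G) : Set G) :=
    Subgroup.le_centralizer_iff.1 le_rfl
  have hc := Subgroup.card_le_of_le hle
  have hm := h (Subgroup.centralizer (H : Set G))
  have hpos : 0 < Nat.card (Subgroup.centralizer (H : Set G)) := Nat.card_pos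
  unfold CDmeasure at hm
  have hc2 : Nat.card (Subgroup.centralizer ((Subgroup.centralizer (H : Set G) : Subgroup G) : Set G))
      ≤ Nat.card H := by nlinarith
  have he := Subgroup.eq_of_le_of_card_ge hle hc2
  refine ⟨fun K => (h K).trans ?_, he.symm⟩
  unfold CDmeasure
  rw [← he, mul_comm]

theorem inCD_sup_inf {G : Type*} [Group G] [Finite G] {H K : Subgroup G} (h : inCD H)
    (k : inCD K) : inCD (H ⊔ K) ∧ inCD (H ⊓ K) ∧
      (∀ g ∈ H ⊔ K, ∃ x ∈ H, ∃ y ∈ K, x * y = g) := by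
  have e1 := card_mul_inf H K
  have e2 := card_mul_inf (Subgroup.centralizer (H : Set G)) (Subgroup.centralizer (K : Set G))
  have s1 : ((H : Set G) * (K : Set G) : Set G) ⊆ ((H ⊔ K : Subgroup G) : Set G) := by
    rintro _ ⟨x, hx, y, hy, rfl⟩
    exact mul_mem (Subgroup.mem_sup_left hx) (Subgroup.mem_sup_right hy)
  have s2 : ((Subgroup.centralizer (H : Set G) : Set G) * (Subgroup.centralizer (K : Set G) : Set G)
      : Set G) ⊆ (Subgroup.centralizer ((H ⊓ K : Subgroup G) : Set G) : Set G) := by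
    rintro _ ⟨x, hx, y, hy, rfl⟩
    exact mul_mem (Subgroup.centralizer_le (Set.inter_subset_left) hx)
      (Subgroup.centralizer_le (Set.inter_subset_right) hy)
  have s3 : (Subgroup.centralizer (H : Set G) ⊓ Subgroup.centralizer (K : Set G)) ≤
      Subgroup.centralizer ((H ⊔ K : Subgroup G) : Set G) := by
    rw [Subgroup.le_centralizer_iff]
    exact sup_le (Subgroup.le_centralizer_iff.1 inf_le_left)
      (Subgroup.le_centralizer_iff.1 inf_le_right)
  have c1 := Nat.card_mono (Set.toFinite _) s1
  have c2 := Nat.card_mono (Set.toFinite _) s2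
  have c3 := Subgroup.card_le_of_le s3
  have m1 := h (H ⊔ K)
  have m2 := h (H ⊓ K)
  have mk : CDmeasure K = CDmeasure H := le_antisymm (h K) (k H)
  have p1 : 0 < CDmeasure H := Nat.mul_pos Nat.card_pos Nat.card_pos
  have key : CDmeasure H * CDmeasure H =
     (Nat.card ((H : Set G) * (K : Set G) : Set G) * Nat.card (Subgroup.centralizer (H : Set G) ⊓
        Subgroup.centralizer (K : Set G) : Subgroup G)) * (Nat.card (H ⊓ K : Subgroup G) *
      Nat.card ((Subgroup.centralizer (H : Set G) : Set G) * (Subgroup.centralizer (K : Set G) : Set G)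
      : Set G)) := by
    nth_rewrite 2 [← mk]
    unfold CDmeasure
    calc _ = (Nat.card H * Nat.card K) * (Nat.card (Subgroup.centralizer (H : Set G)) *
        Nat.card (Subgroup.centralizer (K : Set G))) := by ring
      _ = _ := by rw [← e1, ← e2]; ring
  set u := Nat.card ((H : Set G) * (K : Set G) : Set G) with hu
  set v := Nat.card (Subgroup.centralizer (H : Set G) ⊓
        Subgroup.centralizer (K : Set G) : Subgroup G) with hv
  have q1 : u * v ≤ CDmeasure (H ⊔ K) := Nat.mul_le_mul c1 c3
  have q2 := Nat.mul_le_mul_left (Nat.card (H ⊓ K : Subgroup G)) c2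
  change _ ≤ CDmeasure (H ⊓ K) at q2
  set w := (Nat.card (H ⊓ K : Subgroup G) *
      Nat.card ((Subgroup.centralizer (H : Set G) : Set G) * (Subgroup.centralizer (K : Set G) : Set G)
      : Set G)) with hw
  have uvH : u * v = CDmeasure H := by
    refine le_antisymm (q1.trans m1) ?_
    by_contra hlt
    push Not at hlt
    nlinarith [q2.trans m2]
  have wH : w = CDmeasure H := by
    rw [uvH] at key
    exact (Nat.eq_of_mul_eq_mul_left p1 key).symm
  have d1 : CDmeasure (H ⊔ K) = CDmeasure H := le_antisymm m1 (uvH ▸ q1)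
  have d2 : CDmeasure (H ⊓ K) = CDmeasure H := le_antisymm m2 (wH ▸ q2)
  refine ⟨fun L => d1 ▸ h L, fun L => d2 ▸ h L, ?_⟩
  have hcard : Nat.card (H ⊔ K : Subgroup G) ≤ u := by
    have hvpos : 0 < v := Nat.card_pos
    by_contra hlt
    push Not at hlt
    have : u * v < CDmeasure (H ⊔ K) := by
      unfold CDmeasure
      calc u * v < Nat.card (H ⊔ K : Subgroup G) * v := Nat.mul_lt_mul_of_pos_right hlt hvpos
        _ ≤ _ := Nat.mul_le_mul_left _ c3
    omega
  have hse : ((H : Set G) * (K : Set G) : Set G) = ((H ⊔ K : Subgroup G) : Set G) := by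
    apply Set.eq_of_subset_of_ncard_le s1
    · rw [← Nat.card_coe_set_eq, ← Nat.card_coe_set_eq]; exact hcard
  intro g hg
  have : g ∈ ((H : Set G) * (K : Set G) : Set G) := by rw [hse]; exact hg
  exact Set.mem_mul.1 this

theorem inCD_conj {G : Type*} [Group G] [Finite G] {H : Subgroup G} (h : inCD H) (g : G) :
    inCD (H.map (MulAut.conj g).toMonoidHom) := by
  have hinj : Function.Injective (MulAut.conj g).toMonoidHom := (MulAut.conj g).injective
  have e1 : Nat.card (H.map (MulAut.conj g).toMonoidHom) = Nat.card H :=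
    (Nat.card_congr (H.equivMapOfInjective _ hinj).toEquiv).symm
  have e2 : Nat.card ((Subgroup.centralizer (H : Set G)).map (MulAut.conj g).toMonoidHom)
      = Nat.card (Subgroup.centralizer (H : Set G)) :=
    (Nat.card_congr ((Subgroup.centralizer (H : Set G)).equivMapOfInjective _ hinj).toEquiv).symm
  have hle : (Subgroup.centralizer (H : Set G)).map (MulAut.conj g).toMonoidHom ≤
      Subgroup.centralizer ((H.map (MulAut.conj g).toMonoidHom : Subgroup G) : Set G) := by
    rintro _ ⟨x, hx, rfl⟩
    rw [Subgroup.mem_centralizer_iff]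
    rintro _ ⟨y, hy, rfl⟩
    rw [← map_mul, ← map_mul, Subgroup.mem_centralizer_iff.1 hx y hy]
  have := Subgroup.card_le_of_le hle
  intro K
  refine (h K).trans ?_
  unfold CDmeasure
  rw [e1]
  exact Nat.mul_le_mul_left _ (e2 ▸ this)

/-- The configuration of two self-centralizing abelian subgroups. -/
structure TwoAb {G : Type*} [Group G] (N A B : Subgroup G) : Prop where
  ac : ∀ x ∈ A, ∀ y ∈ A, x * y = y * x
  bc : ∀ x ∈ B, ∀ y ∈ B, x * y = y * x
  na : N ≤ A
  nb : N ≤ B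
  cm : ∀ x ∈ A, ∀ y ∈ B, ⁅x, y⁆ ∈ N
  sc : ∀ b ∈ B, (∀ x ∈ A, ⁅x, b⁆ = 1) → b ∈ N
  ab : ∀ x ∈ A, x ∈ B → x ∈ N

namespace TwoAb

variable {G : Type*} [Group G] {N A B : Subgroup G}

theorem comm_mul_right (h : TwoAb N A B) {x b c : G} (hx : x ∈ A) (hb : b ∈ B) (hc : c ∈ B) :
    ⁅x, b * c⁆ = ⁅x, b⁆ * ⁅x, c⁆ := by
  have h1 := h.bc b hb _ (h.nb (h.cm x hx c hc))
  calc ⁅x, b * c⁆ = ⁅x, b⁆ * (b * ⁅x, c⁆) * b⁻¹ := by simp only [commutatorElement_def]; group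
    _ = _ := by rw [h1]; group

theorem comm_mul_left (h : TwoAb N A B) {x y b : G} (hx : x ∈ A) (hy : y ∈ A) (hb : b ∈ B) :
    ⁅x * y, b⁆ = ⁅x, b⁆ * ⁅y, b⁆ := by
  have h1 := h.ac x hx _ (h.na (h.cm y hy b hb))
  have h2 := h.ac _ (h.na (h.cm x hx b hb)) _ (h.na (h.cm y hy b hb))
  calc ⁅x * y, b⁆ = (x * ⁅y, b⁆) * x⁻¹ * ⁅x, b⁆ := by simp only [commutatorElement_def]; group
    _ = _ := by rw [h1, h2]; group

theorem comm_inv_right (h : TwoAb N A B) {x b : G} (hx : x ∈ A) (hb : b ∈ B) :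
    ⁅x, b⁻¹⁆ = ⁅x, b⁆⁻¹ := by
  rw [eq_inv_iff_mul_eq_one, ← h.comm_mul_right hx (inv_mem hb) hb]; simp

theorem comm_inv_left (h : TwoAb N A B) {x b : G} (hx : x ∈ A) (hb : b ∈ B) :
    ⁅x⁻¹, b⁆ = ⁅x, b⁆⁻¹ := by
  rw [eq_inv_iff_mul_eq_one, ← h.comm_mul_left (inv_mem hx) hx hb]; simp

theorem comm_n_right (h : TwoAb N A B) {x n : G} (hx : x ∈ A) (hn : n ∈ N) : ⁅x, n⁆ = 1 :=
  commutatorElement_eq_one_iff_mul_comm.2 (h.ac x hx n (h.na hn))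

theorem comm_n_left (h : TwoAb N A B) {b n : G} (hb : b ∈ B) (hn : n ∈ N) : ⁅n, b⁆ = 1 :=
  commutatorElement_eq_one_iff_mul_comm.2 (h.bc n (h.nb hn) b hb)

theorem mul_form (h : TwoAb N A B) {a b a' b' : G} (ha : a ∈ A) (hb : b ∈ B) (ha' : a' ∈ A) :
    (a * b) * (a' * b') = ⁅a', b⁆⁻¹ * (a * a' * (b * b')) := by
  have h1 := h.ac a ha _ (inv_mem (h.na (h.cm a' ha' b hb)))
  calc (a * b) * (a' * b') = (a * ⁅a', b⁆⁻¹) * (a' * (b * b')) := by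
        simp only [commutatorElement_def]; group
    _ = _ := by rw [h1]; group

theorem commute_iff (h : TwoAb N A B) {a b a' b' : G} (ha : a ∈ A) (hb : b ∈ B) (ha' : a' ∈ A)
    (hb' : b' ∈ B) : (a * b) * (a' * b') = (a' * b') * (a * b) ↔ ⁅a', b⁆ = ⁅a, b'⁆ := by
  rw [h.mul_form ha hb ha', h.mul_form ha' hb' ha, h.ac a ha a' ha', h.bc b hb b' hb',
    mul_left_inj, inv_inj]

/-- one-sided representability -/
def Rep (A B : Subgroup G) (β : A → A → G) : Prop :=
  ∀ a : A, ∃ b ∈ B, ∀ x : A, ⁅(x : G), b⁆ = β x a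

theorem rep_one : Rep A B (1 : A → A → G) := fun _ => ⟨1, one_mem _, fun x => by simp⟩

theorem rep_mul (h : TwoAb N A B) {β γ : A → A → G} (hβ : Rep A B β) (hγ : Rep A B γ) :
    Rep A B (fun x a => β x a * γ x a) := fun a => by
  obtain ⟨b, hb, e⟩ := hβ a
  obtain ⟨c, hc, f⟩ := hγ a
  exact ⟨b * c, mul_mem hb hc, fun x => by rw [h.comm_mul_right x.2 hb hc, e, f]⟩

theorem rep_inv (h : TwoAb N A B) {β : A → A → G} (hβ : Rep A B β) :
    Rep A B (fun x a => (β x a)⁻¹) := fun a => by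
  obtain ⟨b, hb, e⟩ := hβ a
  exact ⟨b⁻¹, inv_mem hb, fun x => by rw [h.comm_inv_right x.2 hb, e]⟩

/-- forms representable on both sides -/
def T (h : TwoAb N A B) : Subgroup (A → A → G) where
  carrier := {β | Rep A B β ∧ Rep A B (fun x a => β a x)}
  one_mem' := ⟨rep_one, rep_one⟩
  mul_mem' := fun hx hy => ⟨h.rep_mul hx.1 hy.1, h.rep_mul hx.2 hy.2⟩
  inv_mem' := fun hx => ⟨h.rep_inv hx.1, h.rep_inv hx.2⟩

/-- symmetric forms -/
def S (h : TwoAb N A B) : Subgroup (A → A → G) where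
  carrier := {β | β ∈ h.T ∧ ∀ x a, β x a = β a x}
  one_mem' := ⟨one_mem _, fun _ _ => rfl⟩
  mul_mem' := fun hx hy => ⟨mul_mem hx.1 hy.1, fun x a => by
    simp only [Pi.mul_apply]; rw [hx.2 x a, hy.2 x a]⟩
  inv_mem' := fun hx => ⟨inv_mem hx.1, fun x a => by
    simp only [Pi.inv_apply]; rw [hx.2 x a]⟩

theorem T_transpose (h : TwoAb N A B) {β : A → A → G} (hβ : β ∈ h.T) :
    (fun x a => β a x) ∈ h.T := ⟨hβ.2, hβ.1⟩

theorem T_mul (h : TwoAb N A B) {β : A → A → G} (hβ : β ∈ h.T) (x a a' : A) :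
    β x (a * a') = β x a * β x a' := by
  obtain ⟨b, hb, e'⟩ := hβ.2 x
  have e : ∀ a : A, ⁅(a : G), b⁆ = β x a := e'
  rw [← e, ← e, ← e, ← h.comm_mul_left a.2 a'.2 hb]; rfl

theorem T_n (h : TwoAb N A B) {β : A → A → G} (hβ : β ∈ h.T) (x a : A) (ha : (a : G) ∈ N) :
    β x a = 1 := by
  obtain ⟨b, hb, e'⟩ := hβ.2 x
  have e : ∀ a : A, ⁅(a : G), b⁆ = β x a := e'
  rw [← e, h.comm_n_left hb ha]

/-- the graph of a form -/
def GrS (A B : Subgroup G) (β : A → A → G) : Set G :=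
  {g | ∃ a : A, ∃ b ∈ B, (a : G) * b = g ∧ ∀ x : A, ⁅(x : G), b⁆ = β x a}

/-- the subgroup generated by the graph -/
def Gr (A B : Subgroup G) (β : A → A → G) : Subgroup G := Subgroup.closure (GrS A B β)

theorem mem_GrS (h : TwoAb N A B) {β : A → A → G} (hβ : β ∈ h.T) (a : A) {b : G} (hb : b ∈ B) :
    (a : G) * b ∈ GrS A B β ↔ ∀ x : A, ⁅(x : G), b⁆ = β x a := by
  refine ⟨?_, fun H => ⟨a, b, hb, rfl, H⟩⟩
  rintro ⟨a', b', hb', e, H⟩ x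
  have e1 : (a : G)⁻¹ * a' = b * b'⁻¹ := by
    rw [inv_mul_eq_iff_eq_mul, ← mul_assoc, ← e]; group
  have hn : (a : G)⁻¹ * a' ∈ N := h.ab _ (mul_mem (inv_mem a.2) a'.2)
    (by rw [e1]; exact mul_mem hb (inv_mem hb'))
  have hn' : b * b'⁻¹ ∈ N := e1 ▸ hn
  have e2 : a' = a * (a⁻¹ * a') := by group
  have e3 : b = (b * b'⁻¹) * b' := by group
  rw [e3, h.comm_mul_right x.2 (h.nb hn') hb', h.comm_n_right x.2 hn', H x, e2, h.T_mul hβ,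
    h.T_n hβ x (a⁻¹ * a') hn]
  simp

theorem coe_Gr (h : TwoAb N A B) {β : A → A → G} (hβ : β ∈ h.T) (g : G) :
    g ∈ Gr A B β ↔ g ∈ GrS A B β := by
  let U : Subgroup G :=
    { carrier := GrS A B β
      one_mem' := ⟨1, 1, one_mem _, by simp, fun x => by rw [h.T_n hβ x 1 (one_mem _)]; simp⟩
      mul_mem' := by
        rintro _ _ ⟨a, b, hb, rfl, H⟩ ⟨a', b', hb', rfl, H'⟩
        have hn := inv_mem (h.cm a' a'.2 b hb)
        have e : (a * b : G) * (a' * b') = ((a * a' : A) : G) * (⁅(a' : G), b⁆⁻¹ * (b * b')) := by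
          rw [h.mul_form a.2 hb a'.2, ← mul_assoc, h.ac _ (h.na hn) _ (mul_mem a.2 a'.2)]
          simp [mul_assoc]
        rw [e]
        refine ⟨_, _, mul_mem (h.nb hn) (mul_mem hb hb'), rfl, fun x => ?_⟩
        rw [h.comm_mul_right x.2 (h.nb hn) (mul_mem hb hb'), h.comm_n_right x.2 hn,
          h.comm_mul_right x.2 hb hb', H, H', h.T_mul hβ, one_mul]
      inv_mem' := by
        rintro _ ⟨a, b, hb, rfl, H⟩
        have hn := h.cm _ (a⁻¹).2 b hb
        have e : (a * b : G)⁻¹ = ((a⁻¹ : A) : G) * (b⁻¹ * ⁅((a⁻¹ : A) : G), b⁆) := by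
          rw [inv_eq_iff_mul_eq_one, ← mul_assoc (((a⁻¹ : A) : G)), ← mul_assoc,
            h.mul_form a.2 hb (a⁻¹).2]
          simp only [Subgroup.coe_inv, mul_inv_cancel, mul_one, inv_mul_cancel]
        rw [e]
        refine ⟨_, _, mul_mem (inv_mem hb) (h.nb hn), rfl, fun x => ?_⟩
        have h1 := h.T_mul hβ x a a⁻¹
        rw [mul_inv_cancel, h.T_n hβ x 1 (one_mem _)] at h1
        rw [h.comm_mul_right x.2 (inv_mem hb) (h.nb hn), h.comm_n_right x.2 hn,
          h.comm_inv_right x.2 hb, H, mul_one]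
        exact inv_eq_of_mul_eq_one_right h1.symm }
  have : Gr A B β = U := Subgroup.closure_eq U
  rw [this]; rfl

theorem mem_Gr (h : TwoAb N A B) {β : A → A → G} (hβ : β ∈ h.T) (a : A) {b : G} (hb : b ∈ B) :
    (a : G) * b ∈ Gr A B β ↔ ∀ x : A, ⁅(x : G), b⁆ = β x a := by
  rw [h.coe_Gr hβ, h.mem_GrS hβ a hb]

theorem Gr_inj (h : TwoAb N A B) : Set.InjOn (Gr A B) (h.T : Set (A → A → G)) := by
  intro β hβ γ hγ e
  funext x a
  obtain ⟨b, hb, H⟩ := hβ.1 a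
  have h1 := (h.mem_Gr hβ a hb).2 H
  rw [e, h.mem_Gr hγ a hb] at h1
  rw [← H, h1]

theorem Gr_inf (h : TwoAb N A B) {β : A → A → G} (hβ : β ∈ h.T) : Gr A B β ⊓ B = N := by
  have key : ∀ b ∈ B, (b ∈ Gr A B β ↔ ∀ x : A, ⁅(x : G), b⁆ = 1) := by
    intro b hb
    have := h.mem_Gr hβ 1 hb
    simp only [h.T_n hβ _ 1 (one_mem _), Subgroup.coe_one, one_mul] at this
    exact this
  ext b
  constructor
  · rintro ⟨h1, h2⟩
    exact h.sc b h2 fun x hx => (key b h2).1 h1 ⟨x, hx⟩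
  · intro hn
    exact ⟨(key b (h.nb hn)).2 fun x => h.comm_n_right x.2 hn, h.nb hn⟩

theorem Gr_comm (h : TwoAb N A B) {β : A → A → G} (hβ : β ∈ h.T) {g k : G} (hg : g ∈ Gr A B β)
    (hk : k ∈ Gr A B (fun x a => β a x)) : g * k = k * g := by
  rw [h.coe_Gr hβ] at hg
  rw [h.coe_Gr (h.T_transpose hβ)] at hk
  obtain ⟨a, b, hb, rfl, H⟩ := hg
  obtain ⟨a', b', hb', rfl, H'⟩ := hk
  rw [h.commute_iff a.2 hb a'.2 hb', H, H']

theorem Gr_card [Finite G] (h : TwoAb N A B) {β : A → A → G} (hβ : β ∈ h.T) {M : Subgroup G}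
    (hM : ∀ g ∈ M, ∃ x ∈ A, ∃ y ∈ B, x * y = g) :
    Nat.card M * Nat.card N ≤ Nat.card (Gr A B β) * Nat.card B := by
  rw [← card_mul_inf (Gr A B β) B, h.Gr_inf hβ]
  refine Nat.mul_le_mul_right _ (Nat.card_mono (Set.toFinite _) ?_)
  intro g hg
  obtain ⟨a, ha, c, hc, rfl⟩ := hM g hg
  obtain ⟨b, hb, H⟩ := hβ.1 ⟨a, ha⟩
  refine Set.mem_mul.2 ⟨a * b, (h.mem_Gr hβ ⟨a, ha⟩ hb).2 H, b⁻¹ * c, mul_mem (inv_mem hb) hc, ?_⟩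
  group

theorem exists_form (h : TwoAb N A B) {M K L : Subgroup G}
    (hM : ∀ g ∈ M, ∃ x ∈ A, ∃ y ∈ B, x * y = g)
    (KM : K ≤ M) (AM : A ≤ M) (NK : N ≤ K)
    (hK : ∀ g ∈ M, ∃ x ∈ K, ∃ y ∈ B, x * y = g) (hL : ∀ g ∈ M, ∃ x ∈ L, ∃ y ∈ B, x * y = g)
    (hKL : ∀ x ∈ K, ∀ y ∈ L, x * y = y * x) (hKB : ∀ x ∈ K, x ∈ B → x ∈ N) :
    ∃ β ∈ h.T, Gr A B β = K ∧ (K = L → β ∈ h.S) := by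
  have hf : ∀ L : Subgroup G, (∀ g ∈ M, ∃ x ∈ L, ∃ y ∈ B, x * y = g) → ∀ a : A, ∃ b ∈ B,
      (a : G) * b ∈ L := by
    intro L hL a
    obtain ⟨x, hx, y, hy, e⟩ := hL a (AM a.2)
    exact ⟨y⁻¹, inv_mem hy, by rw [← e]; simpa using hx⟩
  choose f fB fK using hf K hK
  choose g gB gL using hf L hL
  have sym : ∀ x a : A, ⁅(x : G), f a⁆ = ⁅(a : G), g x⁆ := fun x a =>
    (h.commute_iff a.2 (fB a) x.2 (gB x)).1 (hKL _ (fK a) _ (gL x))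
  have hT : (fun x a : A => ⁅(x : G), f a⁆) ∈ h.T :=
    ⟨fun a => ⟨f a, fB a, fun x => rfl⟩, fun a => ⟨g a, gB a, fun x => (sym a x).symm⟩⟩
  refine ⟨fun x a => ⁅(x : G), f a⁆, hT, ?_, ?_⟩
  · have main : ∀ a : A, ∀ b ∈ B, ((a : G) * b ∈ Gr A B (fun x a : A => ⁅(x : G), f a⁆) ↔
        (a : G) * b ∈ K) := by
      intro a b hb
      rw [h.mem_Gr hT a hb]
      constructor
      · intro H
        have hn : (f a)⁻¹ * b ∈ N := h.sc _ (mul_mem (inv_mem (fB a)) hb) fun x hx => by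
          rw [h.comm_mul_right hx (inv_mem (fB a)) hb, h.comm_inv_right hx (fB a), H ⟨x, hx⟩]
          exact inv_mul_cancel _
        have := mul_mem (fK a) (NK hn)
        have e : (a : G) * f a * ((f a)⁻¹ * b) = a * b := by group
        rwa [e] at this
      · intro H x
        have hn : (f a)⁻¹ * b ∈ N := by
          refine hKB _ ?_ (mul_mem (inv_mem (fB a)) hb)
          have := mul_mem (inv_mem (fK a)) H
          have e : ((a : G) * f a)⁻¹ * (a * b) = (f a)⁻¹ * b := by group
          rwa [e] at this
        have e : b = f a * ((f a)⁻¹ * b) := by group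
        rw [e, h.comm_mul_right x.2 (fB a) (h.nb hn), h.comm_n_right x.2 hn, mul_one]
    ext k
    constructor
    · intro hk
      obtain ⟨a, b, hb, rfl, -⟩ := (h.coe_Gr hT k).1 hk
      exact (main a b hb).1 hk
    · intro hk
      obtain ⟨a, ha, b, hb, rfl⟩ := hM k (KM hk)
      exact (main ⟨a, ha⟩ b hb).2 hk
  · rintro rfl
    exact ⟨hT, fun x a => (h.commute_iff a.2 (fB a) x.2 (fB x)).1 (hKL _ (fK a) _ (fK x))⟩

end TwoAb

/-- there is no finite group `G` with `N, M ∈ CD(G)`, `N < M`,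
such that `CD(G)` is the quasi-antichain interval `⟦N, M⟧` having exactly 6
atoms of which exactly 4 are abelian. -/
theorem stmt14 (G : Type*) [Group G] [Finite G] (N M : Subgroup G) :
    ¬ (inCD N ∧ inCD M ∧ N < M ∧
      (∀ K : Subgroup G, inCD K → N ≤ K ∧ K ≤ M) ∧
      (∀ K K' : Subgroup G, inCD K → inCD K' → N < K → K ≤ K' → K' < M → K = K') ∧
      {K : Subgroup G | inCD K ∧ N < K ∧ K < M}.ncard = 6 ∧
      {K : Subgroup G | inCD K ∧ N < K ∧ K < M ∧ ∀ x y : K, x * y = y * x}.ncard = 4) := by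
  rintro ⟨hN, hM, hNM, hint, hanti, h6, h4⟩
  -- duality
  have cM : Subgroup.centralizer (M : Set G) = N := by
    apply le_antisymm
    · have := Subgroup.centralizer_le (s := (Subgroup.centralizer (N : Set G) : Set G))
        (t := (M : Set G)) (hint _ (inCD_centralizer hN).1).2
      rwa [(inCD_centralizer hN).2] at this
    · exact (hint _ (inCD_centralizer hM).1).1
  have cN : Subgroup.centralizer (N : Set G) = M := by
    rw [← cM]; exact (inCD_centralizer hM).2
  have cmid : ∀ K : Subgroup G, inCD K → N < K → K < M →
      N < Subgroup.centralizer (K : Set G) ∧ Subgroup.centralizer (K : Set G) < M := by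
    intro K hK h1 h2
    have hc := inCD_centralizer hK
    refine ⟨lt_of_le_of_ne (hint _ hc.1).1 fun e => ?_, lt_of_le_of_ne (hint _ hc.1).2 fun e => ?_⟩
    · have := hc.2; rw [← e, cN] at this; exact h2.ne this.symm
    · have := hc.2; rw [e, cM] at this; exact h1.ne this
  -- lattice facts
  have inf_mid : ∀ K L : Subgroup G, inCD K → N < K → K < M → inCD L → N < L → L < M → K ≠ L →
      K ⊓ L = N ∧ ∀ g ∈ M, ∃ x ∈ K, ∃ y ∈ L, x * y = g := by
    intro K L hK K1 K2 hL L1 L2 hne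
    obtain ⟨s1, s2, s3⟩ := inCD_sup_inf hK hL
    constructor
    · by_contra hcon
      have hlt : N < K ⊓ L := lt_of_le_of_ne (hint _ s2).1 (Ne.symm hcon)
      have a1 := hanti _ _ s2 hK hlt inf_le_left K2
      have a2 := hanti _ _ s2 hL hlt inf_le_right L2
      exact hne (a1.symm.trans a2)
    · have : K ⊔ L = M := by
        by_contra hcon
        have hlt : K ⊔ L < M := lt_of_le_of_ne (hint _ s1).2 hcon
        have a1 := hanti _ _ hK s1 K1 le_sup_left hlt
        have a2 := hanti _ _ hL s1 L1 le_sup_right hlt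
        exact hne (a1.trans a2.symm)
      rw [← this]; exact s3
  have card_conj : ∀ (K : Subgroup G) (g : G),
      Nat.card (K.map (MulAut.conj g).toMonoidHom) = Nat.card K := fun K g =>
    (Nat.card_congr (K.equivMapOfInjective _ (MulAut.conj g).injective).toEquiv).symm
  have norm : ∀ K : Subgroup G, inCD K → N < K → K < M → ∀ g ∈ M, ∀ x ∈ K, g * x * g⁻¹ ∈ K := by
    intro K hK K1 K2 g hg x hx
    have hc := inCD_conj hK g
    have hmem : g * x * g⁻¹ ∈ K.map (MulAut.conj g).toMonoidHom := ⟨x, hx, by simp⟩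
    have c1 : N < K.map (MulAut.conj g).toMonoidHom := by
      refine lt_of_le_of_ne (hint _ hc).1 fun e => ?_
      have := card_conj K g
      rw [← e] at this
      exact K1.ne (Subgroup.eq_of_le_of_card_ge K1.le this.ge)
    have c2 : K.map (MulAut.conj g).toMonoidHom < M := by
      refine lt_of_le_of_ne (hint _ hc).2 fun e => ?_
      have := card_conj K g
      rw [e] at this
      exact K2.ne (Subgroup.eq_of_le_of_card_ge K2.le this.le)
    by_cases hne : K = K.map (MulAut.conj g).toMonoidHom
    · rw [hne]; exact hmem
    · obtain ⟨y, hy, z, hz, e⟩ := (inf_mid _ _ hK K1 K2 hc c1 c2 hne).2 g⁻¹ (inv_mem hg)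
      obtain ⟨w, hw, rfl⟩ := hz
      have hw' : w ∈ K := hw
      have e' : y * (g * w * g⁻¹) = g⁻¹ := by simpa using e
      have hg2 : g ∈ K := by
        have e3 : y * g * w = 1 := by
          apply mul_right_cancel (b := g⁻¹)
          rw [one_mul]; simpa [mul_assoc] using e'
        have e4 : g = y⁻¹ * w⁻¹ := by
          rw [eq_mul_inv_iff_mul_eq]; exact eq_inv_of_mul_eq_one_right (by rw [← mul_assoc]; exact e3)
        rw [e4]; exact mul_mem (inv_mem hy) (inv_mem hw')
      exact mul_mem (mul_mem hg2 hx) (inv_mem hg2)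
  have abel_iff : ∀ K : Subgroup G, inCD K → N < K → K < M → (∀ x y : K, x * y = y * x) →
      Subgroup.centralizer (K : Set G) = K := by
    intro K hK K1 K2 hab
    refine (hanti _ _ hK (inCD_centralizer hK).1 K1 ?_ (cmid K hK K1 K2).2).symm
    intro x hx
    rw [Subgroup.mem_centralizer_iff]
    intro y hy
    exact congrArg Subtype.val (hab ⟨y, hy⟩ ⟨x, hx⟩)
  -- choose A and B
  obtain ⟨A, hA, B, hB, hne⟩ := (Set.one_lt_ncard (Set.toFinite _)).1 (by rw [h4]; norm_num :
    1 < {K : Subgroup G | inCD K ∧ N < K ∧ K < M ∧ ∀ x y : K, x * y = y * x}.ncard)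
  obtain ⟨hA, A1, A2, Aab⟩ := hA
  obtain ⟨hB, B1, B2, Bab⟩ := hB
  have cA := abel_iff A hA A1 A2 Aab
  have cB := abel_iff B hB B1 B2 Bab
  obtain ⟨ABN, ABM⟩ := inf_mid A B hA A1 A2 hB B1 B2 hne
  have h : TwoAb N A B :=
    { ac := fun x hx y hy => congrArg Subtype.val (Aab ⟨x, hx⟩ ⟨y, hy⟩)
      bc := fun x hx y hy => congrArg Subtype.val (Bab ⟨x, hx⟩ ⟨y, hy⟩)
      na := A1.le
      nb := B1.le
      cm := fun x hx y hy => by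
        rw [← ABN]
        constructor
        · have := mul_mem hx (norm A hA A1 A2 y (B2.le hy) x⁻¹ (inv_mem hx))
          simpa [commutatorElement_def, mul_assoc] using this
        · have := mul_mem (norm B hB B1 B2 x (A2.le hx) y hy) (inv_mem hy)
          simpa [commutatorElement_def] using this
      sc := fun b hb H => by
        rw [← ABN]
        refine ⟨?_, hb⟩
        rw [← cA]
        exact Subgroup.mem_centralizer_iff.2 fun x hx =>
          commutatorElement_eq_one_iff_mul_comm.1 (H x hx)
      ab := fun x hx hx' => by rw [← ABN]; exact ⟨hx, hx'⟩ }
  have mBM : Nat.card M * Nat.card N = Nat.card B * Nat.card B := by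
    have : CDmeasure M = CDmeasure B := le_antisymm (hB M) (hM B)
    unfold CDmeasure at this
    rwa [cM, cB] at this
  have Gcard : ∀ β ∈ h.T, Nat.card B ≤ Nat.card (TwoAb.Gr A B β) := by
    intro β hβ
    have := h.Gr_card hβ ABM
    rw [mBM] at this
    exact Nat.le_of_mul_le_mul_right this Nat.card_pos
  have Gmid : ∀ β ∈ h.T, inCD (TwoAb.Gr A B β) ∧ N < TwoAb.Gr A B β ∧ TwoAb.Gr A B β < M ∧
      TwoAb.Gr A B β ≠ B := by
    intro β hβ
    have c1 := Gcard β hβ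
    have c2 := Gcard _ (h.T_transpose hβ)
    have hle : TwoAb.Gr A B (fun x a => β a x) ≤
        Subgroup.centralizer (TwoAb.Gr A B β : Set G) := fun k hk =>
      Subgroup.mem_centralizer_iff.2 fun g hg => h.Gr_comm hβ hg hk
    have c3 := c2.trans (Subgroup.card_le_of_le hle)
    have hcd : inCD (TwoAb.Gr A B β) := by
      intro K
      refine (hB K).trans ?_
      unfold CDmeasure
      rw [cB]
      exact Nat.mul_le_mul c1 c3
    have hinf := h.Gr_inf hβ
    refine ⟨hcd, lt_of_le_of_ne (hint _ hcd).1 ?_, lt_of_le_of_ne (hint _ hcd).2 ?_, ?_⟩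
    · intro e
      rw [← e] at c1
      exact B1.ne (Subgroup.eq_of_le_of_card_ge B1.le c1)
    · intro e
      rw [e, inf_eq_right.2 B2.le] at hinf
      exact B1.ne hinf.symm
    · intro e
      rw [e, inf_idem] at hinf
      exact B1.ne hinf.symm
  have Gsurj : ∀ K : Subgroup G, inCD K → N < K → K < M → K ≠ B → ∃ β ∈ h.T,
      TwoAb.Gr A B β = K ∧ (K = Subgroup.centralizer (K : Set G) → β ∈ h.S) := by
    intro K hK K1 K2 hne
    have hc := inCD_centralizer hK
    have hm := cmid K hK K1 K2
    have hne' : Subgroup.centralizer (K : Set G) ≠ B := by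
      intro e
      have := hc.2
      rw [e, cB] at this
      exact hne this.symm
    have i1 := inf_mid K B hK K1 K2 hB B1 B2 hne
    have i2 := inf_mid _ B hc.1 hm.1 hm.2 hB B1 B2 hne'
    refine h.exists_form ABM K2.le A2.le K1.le i1.2 i2.2 ?_ ?_
    · intro x hx y hy
      exact Subgroup.mem_centralizer_iff.1 hy x hx
    · intro x hx hx'
      rw [← i1.1]; exact ⟨hx, hx'⟩
  have eT : TwoAb.Gr A B '' (h.T : Set (A → A → G)) =
      {K : Subgroup G | inCD K ∧ N < K ∧ K < M} \ {B} := by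
    ext K
    constructor
    · rintro ⟨β, hβ, rfl⟩
      obtain ⟨g1, g2, g3, g4⟩ := Gmid β hβ
      exact ⟨⟨g1, g2, g3⟩, g4⟩
    · rintro ⟨⟨g1, g2, g3⟩, g4⟩
      obtain ⟨β, hβ, e, -⟩ := Gsurj K g1 g2 g3 g4
      exact ⟨β, hβ, e⟩
  have eS : TwoAb.Gr A B '' (h.S : Set (A → A → G)) =
      {K : Subgroup G | inCD K ∧ N < K ∧ K < M ∧ ∀ x y : K, x * y = y * x} \ {B} := by
    ext K
    constructor
    · rintro ⟨β, hβ, rfl⟩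
      obtain ⟨g1, g2, g3, g4⟩ := Gmid β hβ.1
      refine ⟨⟨g1, g2, g3, fun x y => Subtype.ext ?_⟩, g4⟩
      have e : (fun x a => β a x) = β := by
        funext x a; exact hβ.2 a x
      exact h.Gr_comm hβ.1 x.2 (by rw [e]; exact y.2)
    · rintro ⟨⟨g1, g2, g3, gab⟩, g4⟩
      obtain ⟨β, hβ, e, hs⟩ := Gsurj K g1 g2 g3 g4
      exact ⟨β, hs (abel_iff K g1 g2 g3 gab).symm, e⟩
  have hST : h.S ≤ h.T := fun β hβ => hβ.1
  have nT := congrArg Set.ncard eT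
  rw [Set.ncard_image_of_injOn h.Gr_inj, Set.ncard_diff_singleton_of_mem
    (show B ∈ {K : Subgroup G | inCD K ∧ N < K ∧ K < M} from ⟨hB, B1, B2⟩), h6,
    ← Nat.card_coe_set_eq] at nT
  have nS := congrArg Set.ncard eS
  rw [Set.ncard_image_of_injOn (h.Gr_inj.mono hST), Set.ncard_diff_singleton_of_mem
    (show B ∈ {K : Subgroup G | inCD K ∧ N < K ∧ K < M ∧ ∀ x y : K, x * y = y * x} from
      ⟨hB, B1, B2, Bab⟩), h4, ← Nat.card_coe_set_eq] at nS
  have hdvd := Subgroup.card_dvd_of_le hST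
  change Nat.card h.T = 5 at nT
  change Nat.card h.S = 3 at nS
  rw [nT, nS] at hdvd
  omega
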